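/- arXiv:2304.09654 — 2 statements merged into one kernel-verified Lean document; each statement's English description precedes it below -/
import Mathlib

section
/- Let D = (d, T) with d = (d_1, …, d_n), M = Σ_i d_i even and M ≥ 6, and T ≥ 1, and sample a temporal configuration of D uniformly at random. Then the expected number of unordered triples {e, e', e''} of pairwise distinct matched pairs such that, for some i ≠ j, each of e, e', e'' consists of one point of cell P_i and one point of cell P_j and all three are assigned the same timestamp (i.e., the expected number of temporal triple-edges) is at most M_3^2 / (T^2 (M − 1)(M − 3)(M − 5)), where M_3 = Σ_i d_i(d_i − 1)(d_i − 2). -/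
/-- The set `P` of labeled points: cell `P i` consists of `d i` points. -/
abbrev TPoint (n : ℕ) (d : Fin n → ℕ) : Type := (i : Fin n) × Fin (d i)

/-- A temporal configuration of `(d, T)`: a partition of the points into pairs
(encoded as a fixed-point-free involution `pair`) together with a timestamp in `[1, T]`
(encoded as `Fin T`) assigned to each pair (encoded as a function on points that is
constant on each matched pair). -/
structure TConfig (n : ℕ) (d : Fin n → ℕ) (T : ℕ) where
  pair : TPoint n d → TPoint n d
  stamp : TPoint n d → Fin T
  invol : Function.Involutive pair
  nofix : ∀ x, pair x ≠ x
  compat : ∀ x, stamp (pair x) = stamp x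

namespace TConfig

variable {n T : ℕ} {d : Fin n → ℕ}

@[ext]
theorem ext_fields {c c' : TConfig n d T} (hp : c.pair = c'.pair) (hs : c.stamp = c'.stamp) :
    c = c' := by
  cases c; cases c'; simp_all

instance : Finite (TConfig n d T) :=
  Finite.of_injective (fun c => (c.pair, c.stamp)) fun _ _ h =>
    ext_fields (congrArg Prod.fst h) (congrArg Prod.snd h)

/-- Permute the points of a configuration along a permutation. -/
def permute (σ : Equiv.Perm (TPoint n d)) (c : TConfig n d T) : TConfig n d T where
  pair x := σ (c.pair (σ.symm x))
  stamp x := c.stamp (σ.symm x)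
  invol x := by simp [c.invol _]
  nofix x h := c.nofix (σ.symm x) (by simpa using congrArg σ.symm h)
  compat x := by simp [c.compat]

theorem permute_injective (σ : Equiv.Perm (TPoint n d)) :
    Function.Injective (permute (T := T) σ) := by
  intro c c' h
  have hp : ∀ x, (permute σ c).pair x = (permute σ c').pair x := fun x => by rw [h]
  have hs : ∀ x, (permute σ c).stamp x = (permute σ c').stamp x := fun x => by rw [h]
  ext1
  · funext x
    simpa [permute] using hp (σ x)
  · funext x
    simpa [permute] using hs (σ x)

theorem permute_swap_pair {c : TConfig n d T} {x y b : TPoint n d} (hxy : c.pair x = y)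
    (hb : b ≠ x) : (permute (Equiv.swap y b) c).pair x = b := by
  have hyx : y ≠ x := hxy ▸ c.nofix x
  simp [permute, Equiv.swap_apply_of_ne_of_ne hyx.symm hb.symm, hxy]

theorem permute_swap_pair_of_ne {c : TConfig n d T} {u v y b : TPoint n d} (huv : c.pair u = v)
    (hyu : y ≠ u) (hbu : b ≠ u) (hyv : y ≠ v) (hbv : b ≠ v) :
    (permute (Equiv.swap y b) c).pair u = v := by
  simp [permute, Equiv.swap_apply_of_ne_of_ne hyu.symm hbu.symm, huv,
    Equiv.swap_apply_of_ne_of_ne hyv.symm hbv.symm]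

/-- If `S` is stable under swapping `y` with any point outside `U`, then among the members of `S`
every partner of `x` outside `U` is at least as likely as `y`. -/
theorem card_pair_mul_le (S : TConfig n d T → Prop) (U : Finset (TPoint n d)) (x y : TPoint n d)
    (hS : ∀ c, S c → ∀ b ∉ U, S (permute (Equiv.swap y b) c)) :
    Nat.card {c // S c ∧ c.pair x = y} * (∑ i, d i - (insert x U).card) ≤ Nat.card {c // S c} := by
  have hcard : ∑ i, d i - (insert x U).card = Nat.card {b // b ∉ insert x U} := by
    rw [Nat.card_eq_fintype_card, Fintype.card_subtype_compl, Fintype.card_coe]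
    simp
  rw [hcard, ← Nat.card_prod]
  refine Nat.card_le_card_of_injective (fun p : {c // S c ∧ c.pair x = y} × {b // b ∉ insert x U} =>
    (⟨permute (Equiv.swap y p.2.1) p.1.1,
      hS _ p.1.2.1 _ fun h => p.2.2 (Finset.mem_insert_of_mem h)⟩ : {c // S c})) ?_
  rintro ⟨⟨c, hc, hcx⟩, b, hb⟩ ⟨⟨c', hc', hcx'⟩, b', hb'⟩ h
  have h' : permute (Equiv.swap y b) c = permute (Equiv.swap y b') c' := congrArg Subtype.val h
  have hbx : b ≠ x := fun e => hb (by simp [e])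
  have hbx' : b' ≠ x := fun e => hb' (by simp [e])
  have hbb : b = b' := by
    rw [← permute_swap_pair hcx hbx, ← permute_swap_pair hcx' hbx', h']
  subst hbb
  have hcc := permute_injective _ h'
  subst hcc
  rfl

open Classical in
/-- Change the timestamp of the pair containing `x` to `t`. -/
noncomputable def restamp (x : TPoint n d) (t : Fin T) (c : TConfig n d T) : TConfig n d T where
  pair := c.pair
  stamp u := if u = x ∨ u = c.pair x then t else c.stamp u
  invol := c.invol
  nofix := c.nofix
  compat u := by
    have h1 : c.pair u = x ↔ u = c.pair x :=
      ⟨fun h => by rw [← h, c.invol], fun h => by rw [h, c.invol]⟩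
    have h2 : c.pair u = c.pair x ↔ u = x := c.invol.injective.eq_iff
    simp only [h1, h2, c.compat, or_comm]

theorem restamp_stamp_of_ne {c : TConfig n d T} {x u : TPoint n d} (t : Fin T) (h1 : u ≠ x)
    (h2 : u ≠ c.pair x) : (restamp x t c).stamp u = c.stamp u := by
  simp [restamp, h1, h2]

theorem card_stamp_mul_le (S : TConfig n d T → Prop) (x y : TPoint n d) (hxy : y ≠ x)
    (hy : ∀ c, S c → y ≠ c.pair x) (hS : ∀ c, S c → ∀ t, S (restamp x t c)) :
    Nat.card {c // S c ∧ c.stamp x = c.stamp y} * T ≤ Nat.card {c // S c} := by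
  have hcard : Nat.card ({c // S c ∧ c.stamp x = c.stamp y} × Fin T) =
      Nat.card {c // S c ∧ c.stamp x = c.stamp y} * T := by
    rw [Nat.card_prod, Nat.card_fin]
  rw [← hcard]
  refine Nat.card_le_card_of_injective (fun p : {c // S c ∧ c.stamp x = c.stamp y} × Fin T =>
    (⟨restamp x p.2 p.1.1, hS _ p.1.2.1 _⟩ : {c // S c})) ?_
  rintro ⟨⟨c, hc, hcx⟩, t⟩ ⟨⟨c', hc', hcx'⟩, t'⟩ h
  have h' : restamp x t c = restamp x t' c' := congrArg Subtype.val h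
  have hp : (restamp x t c).pair = (restamp x t' c').pair := by rw [h']
  change c.pair = c'.pair at hp
  have hs : ∀ u, (restamp x t c).stamp u = (restamp x t' c').stamp u := fun u => by rw [h']
  have ht : t = t' := by simpa [restamp] using hs x
  have hcy : c.stamp y = c'.stamp y := by
    rw [← restamp_stamp_of_ne t hxy (hy c hc), hs y, restamp_stamp_of_ne t' hxy (hy c' hc')]
  have hcc : c = c' := by
    ext1
    · exact hp
    · funext u
      by_cases h1 : u = x
      · rw [h1, hcx, hcx', hcy]
      · by_cases h2 : u = c.pair x
        · rw [h2, c.compat, hp, c'.compat, hcx, hcx', hcy]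
        · rw [← restamp_stamp_of_ne t h1 h2, hs u, restamp_stamp_of_ne t' h1 (hp ▸ h2)]
  subst hcc ht
  rfl

/-- The configuration contains the pairs `{f k, g k}` for `k : Fin 3`, all with the same
timestamp. -/
def HasTriple (f g : Fin 3 → TPoint n d) (c : TConfig n d T) : Prop :=
  (∀ k, c.pair (f k) = g k) ∧ c.stamp (f 1) = c.stamp (f 0) ∧ c.stamp (f 2) = c.stamp (f 0)

theorem card_hasTriple_mul_le (f g : Fin 3 → TPoint n d) (hf : Function.Injective f)
    (hg : Function.Injective g) (hfg : ∀ k l, f k ≠ g l) :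
    Nat.card {c : TConfig n d T // HasTriple f g c} *
      (T ^ 2 * (∑ i, d i - 1) * (∑ i, d i - 3) * (∑ i, d i - 5)) ≤ Nat.card (TConfig n d T) := by
  have f01 : f 0 ≠ f 1 := hf.ne (by decide)
  have f02 : f 0 ≠ f 2 := hf.ne (by decide)
  have f12 : f 1 ≠ f 2 := hf.ne (by decide)
  have g01 : g 0 ≠ g 1 := hg.ne (by decide)
  have g02 : g 0 ≠ g 2 := hg.ne (by decide)
  have g12 : g 1 ≠ g 2 := hg.ne (by decide)
  have hU1 : (insert (f 1) {f 0, g 0} : Finset (TPoint n d)).card = 3 := by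
    rw [Finset.card_insert_of_notMem (by simp [f01.symm, hfg]), Finset.card_pair (hfg 0 0)]
  have hU2 : (insert (f 2) {f 0, g 0, f 1, g 1} : Finset (TPoint n d)).card = 5 := by
    rw [Finset.card_insert_of_notMem (by simp [f02.symm, f12.symm, hfg]),
      Finset.card_insert_of_notMem (by simp [f01, hfg]),
      Finset.card_insert_of_notMem (by simp [g01, (hfg _ _).symm]), Finset.card_pair (hfg 1 1)]
  have h1 := card_pair_mul_le (T := T) (fun _ => True) ∅ (f 0) (g 0) (fun _ _ _ _ => trivial)
  have h2 := card_pair_mul_le (T := T) (fun c => True ∧ c.pair (f 0) = g 0) {f 0, g 0} (f 1) (g 1)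
    (by
      rintro c ⟨-, h0⟩ b hb
      simp only [Finset.mem_insert, Finset.mem_singleton, not_or] at hb
      exact ⟨trivial, permute_swap_pair_of_ne h0 (hfg _ _).symm hb.1 g01.symm hb.2⟩)
  have h3 := card_pair_mul_le (T := T)
    (fun c => (True ∧ c.pair (f 0) = g 0) ∧ c.pair (f 1) = g 1) {f 0, g 0, f 1, g 1} (f 2) (g 2)
    (by
      rintro c ⟨⟨-, h0⟩, h1⟩ b hb
      simp only [Finset.mem_insert, Finset.mem_singleton, not_or] at hb
      exact ⟨⟨trivial, permute_swap_pair_of_ne h0 (hfg _ _).symm hb.1 g02.symm hb.2.1⟩,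
        permute_swap_pair_of_ne h1 (hfg _ _).symm hb.2.2.1 g12.symm hb.2.2.2⟩)
  have h4 := card_stamp_mul_le (T := T)
    (fun c => ((True ∧ c.pair (f 0) = g 0) ∧ c.pair (f 1) = g 1) ∧ c.pair (f 2) = g 2)
    (f 1) (f 0) f01 (fun c hc => by rw [hc.1.2]; exact hfg _ _) (fun c hc t => hc)
  have h5 := card_stamp_mul_le (T := T)
    (fun c => (((True ∧ c.pair (f 0) = g 0) ∧ c.pair (f 1) = g 1) ∧ c.pair (f 2) = g 2) ∧
      c.stamp (f 1) = c.stamp (f 0))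
    (f 2) (f 0) f02 (fun c hc => by rw [hc.1.2]; exact hfg _ _) (fun c hc t => ⟨hc.1, by
      rw [restamp_stamp_of_ne t f12 (by rw [hc.1.2]; exact hfg _ _),
        restamp_stamp_of_ne t f02 (by rw [hc.1.2]; exact hfg _ _), hc.2]⟩)
  have h6 : Nat.card {c : TConfig n d T // HasTriple f g c} =
      Nat.card {c : TConfig n d T // ((((True ∧ c.pair (f 0) = g 0) ∧ c.pair (f 1) = g 1) ∧
        c.pair (f 2) = g 2) ∧ c.stamp (f 1) = c.stamp (f 0)) ∧ c.stamp (f 2) = c.stamp (f 0)} := by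
    refine Nat.card_congr (Equiv.subtypeEquivRight fun c => ?_)
    simp [HasTriple, Fin.forall_fin_succ, and_assoc]
  have h0 : Nat.card {c : TConfig n d T // True} = Nat.card (TConfig n d T) :=
    Nat.card_congr (Equiv.subtypeUnivEquiv fun _ => trivial)
  rw [hU1] at h2
  rw [hU2] at h3
  rw [h0, insert_empty_eq, Finset.card_singleton] at h1
  rw [h6]
  refine le_trans ?_ h1
  refine le_trans ?_ (Nat.mul_le_mul_right _ h2)
  refine le_trans ?_ (Nat.mul_le_mul_right _ (Nat.mul_le_mul_right _ h3))
  refine le_trans ?_ (Nat.mul_le_mul_right _ (Nat.mul_le_mul_right _ (Nat.mul_le_mul_right _ h4)))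
  refine le_trans (le_of_eq ?_) (Nat.mul_le_mul_right _ (Nat.mul_le_mul_right _
    (Nat.mul_le_mul_right _ (Nat.mul_le_mul_right _ h5))))
  ring

/-- Ordered triples of distinct points in a common cell. -/
abbrev CellTriple (n : ℕ) (d : Fin n → ℕ) : Type := (i : Fin n) × (Fin 3 ↪ Fin (d i))

/-- The points of a cell triple. -/
def CellTriple.point (f : CellTriple n d) (k : Fin 3) : TPoint n d := ⟨f.1, f.2 k⟩

theorem CellTriple.point_injective (f : CellTriple n d) : Function.Injective f.point := by
  intro k l h
  simpa [CellTriple.point] using h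

theorem CellTriple.exists_point {x y z : TPoint n d} (hy : y.1 = x.1) (hz : z.1 = x.1)
    (hxy : y ≠ x) (hxz : z ≠ x) (hyz : z ≠ y) :
    ∃ f : CellTriple n d, f.point 0 = x ∧ f.point 1 = y ∧ f.point 2 = z := by
  obtain ⟨i, x⟩ := x
  obtain ⟨j, y⟩ := y
  obtain ⟨k, z⟩ := z
  dsimp only at hy hz
  subst hy
  subst hz
  have hyx' : y ≠ x := fun h => hxy (by rw [h])
  have hzx' : z ≠ x := fun h => hxz (by rw [h])
  have hzy' : z ≠ y := fun h => hyz (by rw [h])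
  refine ⟨⟨_, ⟨![x, y, z], ?_⟩⟩, rfl, rfl, rfl⟩
  intro a b
  fin_cases a <;> fin_cases b <;> simp [hyx', hzx', hzy', hyx'.symm, hzx'.symm, hzy'.symm]

theorem CellTriple.card_eq : Nat.card (CellTriple n d) = ∑ i, (d i).descFactorial 3 := by
  rw [Nat.card_eq_fintype_card, Fintype.card_sigma]
  simp [Fintype.card_embedding_eq]

/-- `x`, `y`, `z` lie in three distinct pairs of `c` which form a temporal triple-edge. -/
def IsTripleEdge (c : TConfig n d T) (x y z : TPoint n d) : Prop :=
  x.1 ≠ (c.pair x).1 ∧ y ≠ x ∧ y ≠ c.pair x ∧ z ≠ x ∧ z ≠ c.pair x ∧ z ≠ y ∧ z ≠ c.pair y ∧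
    ((y.1 = x.1 ∧ (c.pair y).1 = (c.pair x).1) ∨ (y.1 = (c.pair x).1 ∧ (c.pair y).1 = x.1)) ∧
    ((z.1 = x.1 ∧ (c.pair z).1 = (c.pair x).1) ∨ (z.1 = (c.pair x).1 ∧ (c.pair z).1 = x.1)) ∧
    c.stamp y = c.stamp x ∧ c.stamp z = c.stamp x

/-- If both `y` and `z` lie in the cell of `x`, the triple edge comes from two cell triples. -/
theorem exists_hasTriple {c : TConfig n d T} {x y z : TPoint n d} (hx : x.1 ≠ (c.pair x).1)
    (hyx : y ≠ x) (hzx : z ≠ x) (hzy : z ≠ y)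
    (hy : y.1 = x.1 ∧ (c.pair y).1 = (c.pair x).1) (hz : z.1 = x.1 ∧ (c.pair z).1 = (c.pair x).1)
    (hsy : c.stamp y = c.stamp x) (hsz : c.stamp z = c.stamp x) :
    ∃ f g : CellTriple n d, (f.1 ≠ g.1 ∧ HasTriple f.point g.point c) ∧
      f.point 0 = x ∧ f.point 1 = y ∧ f.point 2 = z ∧
      g.point 0 = c.pair x ∧ g.point 1 = c.pair y ∧ g.point 2 = c.pair z := by
  obtain ⟨f, hf0, hf1, hf2⟩ := CellTriple.exists_point hy.1 hz.1 hyx hzx hzy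
  obtain ⟨g, hg0, hg1, hg2⟩ := CellTriple.exists_point hy.2 hz.2 (c.invol.injective.ne hyx)
    (c.invol.injective.ne hzx) (c.invol.injective.ne hzy)
  refine ⟨f, g, ⟨?_, ?_, ?_, ?_⟩, hf0, hf1, hf2, hg0, hg1, hg2⟩
  · have h1 : f.1 = x.1 := congrArg Sigma.fst hf0
    have h2 : g.1 = (c.pair x).1 := congrArg Sigma.fst hg0
    rwa [h1, h2]
  · simp [Fin.forall_fin_succ, hf0, hf1, hf2, hg0, hg1, hg2]
  · rw [hf0, hf1, hsy]
  · rw [hf0, hf2, hsz]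

theorem card_isTripleEdge_le :
    Nat.card {p : TConfig n d T × TPoint n d × TPoint n d × TPoint n d //
      IsTripleEdge p.1 p.2.1 p.2.2.1 p.2.2.2} ≤
    ∑ q : CellTriple n d × CellTriple n d,
      4 * Nat.card {c : TConfig n d T // q.1.1 ≠ q.2.1 ∧ HasTriple q.1.point q.2.point c} := by
  let W := (q : CellTriple n d × CellTriple n d) × ((Bool × Bool) ×
    {c : TConfig n d T // q.1.1 ≠ q.2.1 ∧ HasTriple q.1.point q.2.point c})
  have hW : Nat.card W = ∑ q : CellTriple n d × CellTriple n d,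
      4 * Nat.card {c : TConfig n d T // q.1.1 ≠ q.2.1 ∧ HasTriple q.1.point q.2.point c} := by
    simp [W, Nat.card_sigma, Nat.card_prod]
  let F : W → TConfig n d T × TPoint n d × TPoint n d × TPoint n d := fun w =>
    (w.2.2.1, w.1.1.point 0, (if w.2.1.1 then w.1.1.point 1 else w.1.2.point 1),
      (if w.2.1.2 then w.1.1.point 2 else w.1.2.point 2))
  have hF : ∀ p : {p : TConfig n d T × TPoint n d × TPoint n d × TPoint n d //
      IsTripleEdge p.1 p.2.1 p.2.2.1 p.2.2.2}, ∃ w, F w = p.1 := by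
    rintro ⟨⟨c, x, y, z⟩, hx, hyx, hypx, hzx, hzpx, hzy, hzpy, hy, hz, hsy, hsz⟩
    dsimp only at hx hyx hypx hzx hzpx hzy hzpy hy hz hsy hsz ⊢
    have flip : ∀ {u v : TPoint n d}, u ≠ c.pair v → c.pair u ≠ v := fun h e =>
      h (by rw [← e, c.invol])
    rcases hy with hy | hy <;> rcases hz with hz | hz
    · obtain ⟨f, g, h, hf0, hf1, hf2, hg0, hg1, hg2⟩ :=
        exists_hasTriple hx hyx hzx hzy hy hz hsy hsz
      exact ⟨⟨(f, g), (true, true), ⟨c, h⟩⟩, by simp [F, *]⟩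
    · obtain ⟨f, g, h, hf0, hf1, hf2, hg0, hg1, hg2⟩ :=
        exists_hasTriple (z := c.pair z) hx hyx (flip hzpx) (flip hzpy) hy
          ⟨hz.2, by rw [c.invol, hz.1]⟩ hsy (by rw [c.compat, hsz])
      exact ⟨⟨(f, g), (true, false), ⟨c, h⟩⟩, by simp [F, *, c.invol z]⟩
    · obtain ⟨f, g, h, hf0, hf1, hf2, hg0, hg1, hg2⟩ :=
        exists_hasTriple (y := c.pair y) hx (flip hypx) hzx hzpy
          ⟨hy.2, by rw [c.invol, hy.1]⟩ hz (by rw [c.compat, hsy]) hsz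
      exact ⟨⟨(f, g), (false, true), ⟨c, h⟩⟩, by simp [F, *, c.invol y]⟩
    · obtain ⟨f, g, h, hf0, hf1, hf2, hg0, hg1, hg2⟩ :=
        exists_hasTriple (y := c.pair y) (z := c.pair z) hx (flip hypx) (flip hzpx)
          (c.invol.injective.ne hzy) ⟨hy.2, by rw [c.invol, hy.1]⟩
          ⟨hz.2, by rw [c.invol, hz.1]⟩ (by rw [c.compat, hsy]) (by rw [c.compat, hsz])
      exact ⟨⟨(f, g), (false, false), ⟨c, h⟩⟩, by simp [F, *, c.invol y, c.invol z]⟩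
  choose G hG using hF
  rw [← hW]
  refine Nat.card_le_card_of_injective G fun p p' h => Subtype.ext ?_
  rw [← hG p, ← hG p', h]

theorem card_isTripleEdge_mul_le :
    Nat.card {p : TConfig n d T × TPoint n d × TPoint n d × TPoint n d //
      IsTripleEdge p.1 p.2.1 p.2.2.1 p.2.2.2} *
      (T ^ 2 * (∑ i, d i - 1) * (∑ i, d i - 3) * (∑ i, d i - 5)) ≤
    4 * (∑ i, (d i).descFactorial 3) ^ 2 * Nat.card (TConfig n d T) := by
  refine (Nat.mul_le_mul_right _ card_isTripleEdge_le).trans ?_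
  rw [Finset.sum_mul]
  have key : ∀ q : CellTriple n d × CellTriple n d,
      4 * Nat.card {c : TConfig n d T // q.1.1 ≠ q.2.1 ∧ HasTriple q.1.point q.2.point c} *
        (T ^ 2 * (∑ i, d i - 1) * (∑ i, d i - 3) * (∑ i, d i - 5)) ≤
      4 * Nat.card (TConfig n d T) := by
    rintro ⟨f, g⟩
    rw [mul_assoc]
    refine Nat.mul_le_mul_left _ ?_
    by_cases hfg : f.1 = g.1
    · simp [hfg]
    · simp only [ne_eq, hfg, not_false_eq_true, true_and]
      exact card_hasTriple_mul_le _ _ f.point_injective g.point_injective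
        fun k l h => hfg (congrArg (fun u : TPoint n d => u.1) h)
  refine (Finset.sum_le_sum fun q _ => key q).trans (le_of_eq ?_)
  rw [Finset.sum_const, Finset.card_univ, ← Nat.card_eq_fintype_card, Nat.card_prod,
    CellTriple.card_eq, smul_eq_mul]
  ring

end TConfig

theorem Nat.cast_descFactorial_three_real (a : ℕ) :
    (a.descFactorial 3 : ℝ) = (a : ℝ) * ((a : ℝ) - 1) * ((a : ℝ) - 2) := by
  rcases a with _ | _ | a
  · simp
  · simp
  · simp [Nat.descFactorial]
    ring

/-- The expected number of temporal triple-edges (unordered triples `{e, e', e''}` of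
pairwise distinct matched pairs with, for some `i ≠ j`, one point of each in cell `i` and
one in cell `j`, and all three the same timestamp) of a uniformly random temporal
configuration is at most `M₃² / (T² (M-1)(M-3)(M-5))`.  Each such unordered triple is
witnessed by exactly `48` tuples (configuration, x, y, z) below. -/
theorem stmt6 (n T : ℕ) (d : Fin n → ℕ) (M : ℕ) (hM : M = ∑ i, d i)
    (hEven : Even M) (hM6 : 6 ≤ M) (hT : 1 ≤ T) :
    (Nat.card {p : TConfig n d T × TPoint n d × TPoint n d × TPoint n d //
        (p.2.1).1 ≠ (p.1.pair p.2.1).1 ∧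
        p.2.2.1 ≠ p.2.1 ∧ p.2.2.1 ≠ p.1.pair p.2.1 ∧
        p.2.2.2 ≠ p.2.1 ∧ p.2.2.2 ≠ p.1.pair p.2.1 ∧
        p.2.2.2 ≠ p.2.2.1 ∧ p.2.2.2 ≠ p.1.pair p.2.2.1 ∧
        (((p.2.2.1).1 = (p.2.1).1 ∧ (p.1.pair p.2.2.1).1 = (p.1.pair p.2.1).1) ∨
          ((p.2.2.1).1 = (p.1.pair p.2.1).1 ∧ (p.1.pair p.2.2.1).1 = (p.2.1).1)) ∧
        (((p.2.2.2).1 = (p.2.1).1 ∧ (p.1.pair p.2.2.2).1 = (p.1.pair p.2.1).1) ∨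
          ((p.2.2.2).1 = (p.1.pair p.2.1).1 ∧ (p.1.pair p.2.2.2).1 = (p.2.1).1)) ∧
        p.1.stamp p.2.2.1 = p.1.stamp p.2.1 ∧
        p.1.stamp p.2.2.2 = p.1.stamp p.2.1} : ℝ) /
      (48 * Nat.card (TConfig n d T)) ≤
    (∑ i, (d i : ℝ) * ((d i : ℝ) - 1) * ((d i : ℝ) - 2)) ^ 2 /
      ((T : ℝ) ^ 2 * ((M : ℝ) - 1) * ((M : ℝ) - 3) * ((M : ℝ) - 5)) := by
  have hmain := TConfig.card_isTripleEdge_mul_le (n := n) (d := d) (T := T)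
  rw [← hM] at hmain
  change (Nat.card {p : TConfig n d T × TPoint n d × TPoint n d × TPoint n d //
    TConfig.IsTripleEdge p.1 p.2.1 p.2.2.1 p.2.2.2} : ℝ) / _ ≤ _
  have hreal := (Nat.cast_le (α := ℝ)).2 hmain
  push_cast [Nat.cast_sub (show 1 ≤ M by omega), Nat.cast_sub (show 3 ≤ M by omega),
    Nat.cast_sub (show 5 ≤ M by omega), Nat.cast_descFactorial_three_real] at hreal
  have hM' : (6 : ℝ) ≤ M := by exact_mod_cast hM6
  have hT' : (0 : ℝ) < T := by exact_mod_cast hT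
  have hD : 0 < (T : ℝ) ^ 2 * ((M : ℝ) - 1) * ((M : ℝ) - 3) * ((M : ℝ) - 5) :=
    mul_pos (mul_pos (mul_pos (by positivity) (by linarith)) (by linarith)) (by linarith)
  rcases (Nat.cast_nonneg (α := ℝ) (Nat.card (TConfig n d T))).eq_or_lt with hN | hN
  · rw [← hN, mul_zero, div_zero]
    exact div_nonneg (sq_nonneg _) hD.le
  · rw [div_le_div_iff₀ (by positivity) hD]
    refine hreal.trans ?_
    have := mul_nonneg (sq_nonneg (∑ i, (d i : ℝ) * ((d i : ℝ) - 1) * ((d i : ℝ) - 2))) hN.le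
    linarith
end

section
/- Let D = (d, T) with d = (d_1, …, d_n), M = Σ_i d_i even, T ≥ 1, let m ≥ 1 with 2m ≤ M, and sample a temporal configuration of D uniformly at random. Then the expected number of unordered pairs {i, j} of distinct indices such that at least m matched pairs consist of one point of cell P_i and one point of cell P_j (i.e., the expected number of node pairs joined by an ordinary multi-edge of multiplicity at least m) is at most M_m^2 / (m! · ∏_{k=0}^{m-1} (M − 2k − 1)), where M_m = Σ_i d_i(d_i − 1)⋯(d_i − m + 1). -/
namespace TConfig

variable {n T : ℕ} {d : Fin n → ℕ}

theorem ext_pair_stamp {C C' : TConfig n d T} (hp : C.pair = C'.pair)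
    (hs : C.stamp = C'.stamp) : C = C' := by
  cases C
  cases C'
  simp_all

instance finite : Finite (TConfig n d T) :=
  Finite.of_injective (fun C : TConfig n d T => (C.pair, C.stamp)) fun _ _ h =>
    ext_pair_stamp (congrArg Prod.fst h) (congrArg Prod.snd h)

/-- Relabelling the points of a temporal configuration along a permutation. -/
def relabel (σ : Equiv.Perm (TPoint n d)) (C : TConfig n d T) : TConfig n d T where
  pair x := σ (C.pair (σ.symm x))
  stamp x := C.stamp (σ.symm x)
  invol x := by simp [C.invol (σ.symm x)]
  nofix x h := C.nofix (σ.symm x) (by rw [Equiv.eq_symm_apply, h])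
  compat x := by simp [C.compat]

theorem relabel_injective (σ : Equiv.Perm (TPoint n d)) :
    Function.Injective (relabel (T := T) σ) := by
  intro C C' h
  have hp := congrArg TConfig.pair h
  have hs := congrArg TConfig.stamp h
  refine ext_pair_stamp (funext fun x => ?_) (funext fun x => ?_)
  · simpa [relabel] using congrFun hp (σ x)
  · simpa [relabel] using congrFun hs (σ x)

theorem card_prescribed_succ {m : ℕ} (a b : Fin m → TPoint n d) (hb : Function.Injective b)
    (hab : ∀ k l, a k ≠ b l) (k : Fin m) :
    (∑ i, d i - (2 * k + 1)) *
        Nat.card {C : TConfig n d T // ∀ l : Fin m, (l : ℕ) < k + 1 → C.pair (a l) = b l} ≤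
      Nat.card {C : TConfig n d T // ∀ l : Fin m, (l : ℕ) < k → C.pair (a l) = b l} := by
  classical
  set S : Finset (TPoint n d) := (Finset.Iic k).image a ∪ (Finset.Iio k).image b with hS
  have hScard : S.card ≤ 2 * k + 1 := by
    refine (Finset.card_union_le _ _).trans ?_
    have h₁ : ((Finset.Iic k).image a).card ≤ k + 1 :=
      Finset.card_image_le.trans (by simp)
    have h₂ : ((Finset.Iio k).image b).card ≤ k :=
      Finset.card_image_le.trans (by simp)
    omega
  have hcompl : ∑ i, d i - (2 * k + 1) ≤ Nat.card {y // y ∉ S} := by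
    have : Nat.card {y // y ∉ S} = ∑ i, d i - S.card := by
      rw [Nat.card_eq_fintype_card, Fintype.card_subtype_compl]
      simp
    omega
  refine (Nat.mul_le_mul_right _ hcompl).trans ?_
  rw [← Nat.card_prod]
  have hSa : ∀ y, y ∉ S → ∀ l ≤ k, a l ≠ y := by
    rintro y hy l hl rfl
    exact hy (Finset.mem_union_left _ (Finset.mem_image_of_mem a (Finset.mem_Iic.2 hl)))
  have hSb : ∀ y, y ∉ S → ∀ l < k, b l ≠ y := by
    rintro y hy l hl rfl
    exact hy (Finset.mem_union_right _ (Finset.mem_image_of_mem b (Finset.mem_Iio.2 hl)))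
  have key : ∀ y, y ∉ S → ∀ C : TConfig n d T,
      (∀ l : Fin m, (l : ℕ) < k + 1 → C.pair (a l) = b l) → ∀ l ≤ k,
      (relabel (Equiv.swap y (b k)) C).pair (a l) = Equiv.swap y (b k) (b l) := by
    intro y hy C hC l hl
    have hl' : (l : ℕ) < k + 1 := Nat.lt_succ_of_le hl
    simp only [relabel, Equiv.symm_swap]
    rw [Equiv.swap_apply_of_ne_of_ne (hSa y hy l hl) (hab l k), hC l hl']
  refine Nat.card_le_card_of_injective (fun p : {y // y ∉ S} × _ =>
    ⟨relabel (Equiv.swap p.1.1 (b k)) p.2.1, fun l hl => ?_⟩) ?_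
  · have hl' : l < k := hl
    rw [key p.1.1 p.1.2 _ p.2.2 l hl'.le, Equiv.swap_apply_of_ne_of_ne (hSb _ p.1.2 l hl')
      (hb.ne hl'.ne)]
  · rintro ⟨⟨y, hy⟩, C, hC⟩ ⟨⟨y', hy'⟩, C', hC'⟩ h
    have h' : relabel (Equiv.swap y (b k)) C = relabel (Equiv.swap y' (b k)) C' :=
      congrArg Subtype.val h
    have hyy : y = y' := by
      have h₁ := key y hy C hC k le_rfl
      have h₂ := key y' hy' C' hC' k le_rfl
      rw [Equiv.swap_apply_right] at h₁ h₂
      rw [← h₁, ← h₂, h']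
    subst hyy
    obtain rfl := relabel_injective _ h'
    rfl

theorem card_prescribed_le {m : ℕ} (a b : Fin m → TPoint n d) (hb : Function.Injective b)
    (hab : ∀ k l, a k ≠ b l) :
    (∏ k ∈ Finset.range m, (∑ i, d i - (2 * k + 1))) *
        Nat.card {C : TConfig n d T // ∀ l, C.pair (a l) = b l} ≤
      Nat.card (TConfig n d T) := by
  have h : ∀ k ≤ m, (∏ k ∈ Finset.range k, (∑ i, d i - (2 * k + 1))) *
        Nat.card {C : TConfig n d T // ∀ l : Fin m, (l : ℕ) < k → C.pair (a l) = b l} ≤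
      Nat.card (TConfig n d T) := by
    intro k
    induction k with
    | zero => intro _; simp
    | succ k ih =>
      intro hk
      rw [Finset.prod_range_succ, mul_assoc]
      exact (Nat.mul_le_mul_left _ (card_prescribed_succ a b hb hab ⟨k, hk⟩)).trans
        (ih (Nat.le_of_succ_le hk))
  simpa using h m le_rfl

theorem exists_injective_perm {m : ℕ} (C : TConfig n d T) (i j : Fin n)
    (h : m ≤ Nat.card {x : TPoint n d // x.1 = i ∧ (C.pair x).1 = j}) :
    ∃ F : Equiv.Perm (Fin m) → (Fin m ↪ Fin (d i)) × (Fin m ↪ Fin (d j)),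
      Function.Injective F ∧ ∀ s k, C.pair ⟨i, (F s).1 k⟩ = ⟨j, (F s).2 k⟩ := by
  have hX : m ≤ Nat.card {u : Fin (d i) // (C.pair ⟨i, u⟩).1 = j} := by
    refine h.trans (Nat.card_le_card_of_surjective
      (fun u => ⟨⟨i, u.1⟩, rfl, u.2⟩) ?_)
    rintro ⟨⟨i', u⟩, rfl, hu⟩
    exact ⟨⟨u, hu⟩, rfl⟩
  have hg : ∀ u : {u : Fin (d i) // (C.pair ⟨i, u⟩).1 = j}, ∃ v : Fin (d j),
      C.pair ⟨i, u.1⟩ = ⟨j, v⟩ := by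
    rintro ⟨u, rfl⟩
    exact ⟨_, rfl⟩
  choose g hg using hg
  have hginj : Function.Injective g := by
    intro u v huv
    have : C.pair ⟨i, u.1⟩ = C.pair ⟨i, v.1⟩ := by rw [hg, hg, huv]
    simpa [Subtype.ext_iff] using C.invol.injective this
  obtain ⟨e⟩ : Nonempty (Fin m ↪ {u : Fin (d i) // (C.pair ⟨i, u⟩).1 = j}) := by
    refine Function.Embedding.nonempty_of_card_le ?_
    simpa [Nat.card_eq_fintype_card] using hX
  refine ⟨fun s => ((s.toEmbedding.trans e).trans (Function.Embedding.subtype _),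
    (s.toEmbedding.trans e).trans ⟨g, hginj⟩), fun s t hst => ?_, fun s k => hg _⟩
  refine Equiv.ext fun k => ?_
  have := DFunLike.congr_fun (congrArg Prod.fst hst) k
  simpa [Subtype.val_inj] using this

theorem card_multiEdge_mul_le (m : ℕ) :
    Nat.card {p : TConfig n d T × (Fin n × Fin n) //
        p.2.1 ≠ p.2.2 ∧
        m ≤ Nat.card {x : TPoint n d // x.1 = p.2.1 ∧ (p.1.pair x).1 = p.2.2}} *
      (m.factorial * ∏ k ∈ Finset.range m, (∑ i, d i - (2 * k + 1))) ≤
    (∑ i, (d i).descFactorial m) ^ 2 * Nat.card (TConfig n d T) := by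
  classical
  let W := Σ q : Fin n × Fin n, (Fin m ↪ Fin (d q.1)) × (Fin m ↪ Fin (d q.2))
  let P (w : W) (C : TConfig n d T) : Prop :=
    w.1.1 ≠ w.1.2 ∧ ∀ k, C.pair ⟨w.1.1, w.2.1 k⟩ = ⟨w.1.2, w.2.2 k⟩
  have hW : Nat.card W = (∑ i, (d i).descFactorial m) ^ 2 := by
    rw [Nat.card_sigma, sq, Finset.sum_mul_sum, ← Finset.sum_product']
    simp [Fintype.card_embedding_eq]
  have hP (w : W) : (∏ k ∈ Finset.range m, (∑ i, d i - (2 * k + 1))) *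
      Nat.card {C // P w C} ≤ Nat.card (TConfig n d T) := by
    by_cases hw : w.1.1 = w.1.2
    · have : IsEmpty {C // P w C} := ⟨fun C => C.2.1 hw⟩
      simp
    · simp only [P, ne_eq, hw, not_false_eq_true, true_and]
      refine card_prescribed_le (fun k => ⟨w.1.1, w.2.1 k⟩) (fun k => ⟨w.1.2, w.2.2 k⟩)
        (fun k l h => by simpa using h) (fun k l h => hw (congrArg Sigma.fst h))
  choose F hF hFpair using fun p : {p : TConfig n d T × (Fin n × Fin n) //
      p.2.1 ≠ p.2.2 ∧
      m ≤ Nat.card {x : TPoint n d // x.1 = p.2.1 ∧ (p.1.pair x).1 = p.2.2}} =>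
    exists_injective_perm p.1.1 p.1.2.1 p.1.2.2 p.2.2
  have hcount : Nat.card {p : TConfig n d T × (Fin n × Fin n) //
        p.2.1 ≠ p.2.2 ∧
        m ≤ Nat.card {x : TPoint n d // x.1 = p.2.1 ∧ (p.1.pair x).1 = p.2.2}} *
      m.factorial ≤ ∑ w : W, Nat.card {C // P w C} := by
    have hperm : m.factorial = Nat.card (Equiv.Perm (Fin m)) := by
      simp [Fintype.card_perm]
    rw [hperm, ← Nat.card_prod, ← Nat.card_sigma]
    refine Nat.card_le_card_of_injective (fun q =>
      ⟨⟨q.1.1.2, F q.1 q.2⟩, ⟨q.1.1.1, q.1.2.1, hFpair q.1 q.2⟩⟩) ?_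
    rintro ⟨p, s⟩ ⟨p', s'⟩ h
    have hw : (⟨p.1.2, F p s⟩ : W) = ⟨p'.1.2, F p' s'⟩ := congrArg Sigma.fst h
    have hC : p.1.1 = p'.1.1 :=
      congrArg (fun z : (Σ w : W, {C // P w C}) => z.2.1) h
    obtain rfl : p = p' := Subtype.ext (Prod.ext hC (congrArg Sigma.fst hw))
    obtain rfl : s = s' := hF p (eq_of_heq (Sigma.mk.inj hw).2)
    rfl
  rw [← mul_assoc, ← hW]
  refine (Nat.mul_le_mul_right _ hcount).trans ?_
  rw [mul_comm, Finset.mul_sum, Nat.card_eq_fintype_card (α := W)]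
  simpa using Finset.sum_le_sum fun w (_ : w ∈ Finset.univ) => hP w

end TConfig

/-- The expected number of unordered pairs `{i, j}` of distinct indices such that at least
`m` matched pairs of a uniformly random temporal configuration consist of one point of cell
`i` and one point of cell `j` (node pairs joined by an ordinary multi-edge of multiplicity
at least `m`) is at most `M_m² / (m! · ∏_{k=0}^{m-1} (M - 2k - 1))`.  For `i ≠ j`, each
matched `i`-`j` pair is witnessed by exactly one point `x` with `x.1 = i, (pair x).1 = j`,
and each unordered pair `{i, j}` is counted by two ordered pairs, whence the factor `2`. -/
theorem stmt9 (n T : ℕ) (d : Fin n → ℕ) (M m : ℕ) (hM : M = ∑ i, d i)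
    (hEven : Even M) (hm : 1 ≤ m) (hmM : 2 * m ≤ M) (hT : 1 ≤ T) :
    (Nat.card {p : TConfig n d T × (Fin n × Fin n) //
        p.2.1 ≠ p.2.2 ∧
        m ≤ Nat.card {x : TPoint n d // x.1 = p.2.1 ∧ (p.1.pair x).1 = p.2.2}} : ℝ) /
      (2 * Nat.card (TConfig n d T)) ≤
    (∑ i, ((d i).descFactorial m : ℝ)) ^ 2 /
      ((m.factorial : ℝ) * ∏ k ∈ Finset.range m, ((M : ℝ) - 2 * (k : ℝ) - 1)) := by
  have hprod : ((∏ k ∈ Finset.range m, (∑ i, d i - (2 * k + 1)) : ℕ) : ℝ) =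
      ∏ k ∈ Finset.range m, ((M : ℝ) - 2 * (k : ℝ) - 1) := by
    rw [Nat.cast_prod]
    refine Finset.prod_congr rfl fun k hk => ?_
    have hk := Finset.mem_range.1 hk
    rw [← hM, Nat.cast_sub (by omega)]
    push_cast
    ring
  have hpos : 0 < (m.factorial : ℝ) * ∏ k ∈ Finset.range m, ((M : ℝ) - 2 * (k : ℝ) - 1) := by
    refine mul_pos (by positivity) (Finset.prod_pos fun k hk => ?_)
    have hk : 2 * k + 2 ≤ M := by have := Finset.mem_range.1 hk; omega
    have : (2 * k + 2 : ℝ) ≤ M := by exact_mod_cast hk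
    linarith
  have key := (Nat.cast_le (α := ℝ)).2 (TConfig.card_multiEdge_mul_le (T := T) (d := d) m)
  simp only [Nat.cast_mul, Nat.cast_pow, Nat.cast_sum, hprod] at key
  rcases (Nat.card (TConfig n d T)).eq_zero_or_pos with h0 | h0
  · rw [h0]
    simp only [Nat.cast_zero, mul_zero, div_zero]
    positivity
  have h0 : (0 : ℝ) < Nat.card (TConfig n d T) := by exact_mod_cast h0
  rw [div_le_div_iff₀ (by positivity) hpos]
  exact key.trans (mul_le_mul_of_nonneg_left (by linarith) (by positivity))
end
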